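/- Assume ∫_ℝ |φ(u+iv)| / |u+iv| du < ∞. Then for every x ∈ ℝ, ∫_{(x,∞)} e^{s} μ(ds) = −(1/2π) ∫_ℝ e^{(1+i(u+iv))x} · φ(u+iv) / (1+i(u+iv)) du. -/

import Mathlib

open MeasureTheory

open Filter Topology

open scoped FourierTransform

/-- The kernel `(x, s) ↦ 1_{x < s} e^{c x} e^s` is integrable for `dx ⊗ μ(ds)`. -/
lemma integrable_indicator_exp_mul_exp {μ : Measure ℝ} [SFinite μ] {c : ℂ} (hc : 0 < c.re)
    (hμ : Integrable (fun s : ℝ => Real.exp ((c.re + 1) * s)) μ) :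
    Integrable (Function.uncurry fun x s : ℝ =>
      (Set.Iio s).indicator (fun x : ℝ => Complex.exp (c * x)) x * Complex.exp s)
      (volume.prod μ) := by
  have hmeas : Measurable (Function.uncurry fun x s : ℝ =>
      (Set.Iio s).indicator (fun x : ℝ => Complex.exp (c * x)) x * Complex.exp s) := by
    have hset : MeasurableSet {p : ℝ × ℝ | p.1 < p.2} :=
      measurableSet_lt measurable_fst measurable_snd
    have : Measurable ({p : ℝ × ℝ | p.1 < p.2}.indicator
        (fun p : ℝ × ℝ => Complex.exp (c * p.1) * Complex.exp p.2)) :=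
      Measurable.indicator (by fun_prop) hset
    convert this using 1
    ext ⟨x, s⟩
    by_cases h : x < s <;> simp [Function.uncurry, h]
  rw [integrable_prod_iff' hmeas.aestronglyMeasurable]
  refine ⟨.of_forall fun s => ?_, ?_⟩
  · simp only [Function.uncurry]
    exact ((integrable_indicator_iff measurableSet_Iio).2
      ((integrableOn_exp_mul_complex_Iic hc s).mono_set Set.Iio_subset_Iic_self)).mul_const _
  · refine (hμ.div_const c.re).congr (.of_forall fun s => ?_)
    simp only [Function.uncurry, norm_mul, norm_indicator_eq_indicator_norm, integral_mul_const,
      Complex.norm_exp]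
    rw [integral_indicator measurableSet_Iio, ← integral_Iic_eq_integral_Iio]
    simp only [Complex.mul_re, Complex.ofReal_re, Complex.ofReal_im, mul_zero, sub_zero]
    rw [integral_exp_mul_Iic hc, add_mul, Real.exp_add, one_mul]
    ring

lemma integral_indicator_exp_mul_exp (μ : Measure ℝ) (c : ℂ) (x : ℝ) :
    ∫ s : ℝ, (Set.Iio s).indicator (fun x : ℝ => Complex.exp (c * x)) x * Complex.exp s ∂μ =
      Complex.exp (c * x) * ((∫ s in Set.Ioi x, Real.exp s ∂μ : ℝ) : ℂ) := by
  rw [← integral_complex_ofReal, ← integral_const_mul, ← integral_indicator measurableSet_Ioi]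
  congr 1 with s
  by_cases h : x < s <;> simp [h]

lemma integrable_exp_mul_setIntegral_Ioi_exp {μ : Measure ℝ} [SFinite μ] {c : ℂ} (hc : 0 < c.re)
    (hμ : Integrable (fun s : ℝ => Real.exp ((c.re + 1) * s)) μ) :
    Integrable fun x : ℝ =>
      Complex.exp (c * x) * ((∫ s in Set.Ioi x, Real.exp s ∂μ : ℝ) : ℂ) := by
  simpa only [Function.uncurry, integral_indicator_exp_mul_exp] using
    (integrable_indicator_exp_mul_exp hc hμ).integral_prod_left

/-- The bilateral Laplace transform of the exponential tail `x ↦ ∫_{(x,∞)} e^s μ(ds)`. -/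
lemma integral_exp_mul_setIntegral_Ioi_exp {μ : Measure ℝ} [SFinite μ] {c : ℂ} (hc : 0 < c.re)
    (hμ : Integrable (fun s : ℝ => Real.exp ((c.re + 1) * s)) μ) :
    ∫ x : ℝ, Complex.exp (c * x) * ((∫ s in Set.Ioi x, Real.exp s ∂μ : ℝ) : ℂ) =
      (∫ s : ℝ, Complex.exp ((c + 1) * s) ∂μ) / c := by
  simp_rw [← integral_indicator_exp_mul_exp]
  rw [integral_integral_swap (integrable_indicator_exp_mul_exp hc hμ), ← integral_div]
  congr 1 with s
  rw [integral_mul_const, integral_indicator measurableSet_Iio, ← integral_Iic_eq_integral_Iio,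
    integral_exp_mul_complex_Iic hc, add_mul, one_mul, Complex.exp_add]
  ring

lemma antitone_setIntegral_Ioi_exp {μ : Measure ℝ} (hμ : Integrable Real.exp μ) :
    Antitone fun x : ℝ => ∫ s in Set.Ioi x, Real.exp s ∂μ := fun _ _ hxy =>
  setIntegral_mono_set hμ.integrableOn (.of_forall fun s => (Real.exp_pos s).le)
    (Set.Ioi_subset_Ioi hxy).eventuallyLE

lemma tendsto_setIntegral_Ioi_nhdsGT {μ : Measure ℝ} {f : ℝ → ℝ} (hf : Integrable f μ) (x : ℝ) :
    Tendsto (fun y : ℝ => ∫ s in Set.Ioi y, f s ∂μ) (𝓝[>] x) (𝓝 (∫ s in Set.Ioi x, f s ∂μ)) := by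
  simp_rw [← integral_indicator (measurableSet_Ioi (α := ℝ))]
  refine tendsto_integral_filter_of_dominated_convergence (fun s => ‖f s‖)
    (.of_forall fun y => hf.aestronglyMeasurable.indicator measurableSet_Ioi)
    (.of_forall fun y => .of_forall fun s => norm_indicator_le_norm_self _ _) hf.norm
    (.of_forall fun s => tendsto_const_nhds.congr' ?_)
  rcases lt_or_ge x s with h | h
  · filter_upwards [mem_nhdsWithin_of_mem_nhds (Iio_mem_nhds h)] with y hy
    simp [h, Set.mem_Iio.1 hy]
  · filter_upwards [self_mem_nhdsWithin] with y hy
    simp [h, h.trans (Set.mem_Ioi.1 hy).le]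

lemma norm_le_mul_norm_one_add_I_mul {v : ℝ} (hv : 1 < v) (u : ℝ) :
    ‖(u : ℂ) + v * Complex.I‖ ≤
      (1 + 1 / (v - 1)) * ‖1 + Complex.I * ((u : ℂ) + v * Complex.I)‖ := by
  set z : ℂ := (u : ℂ) + v * Complex.I with hz
  have hre : v - 1 ≤ ‖1 + Complex.I * z‖ := by
    have := Complex.abs_re_le_norm (1 + Complex.I * z)
    have hre : (1 + Complex.I * z).re = 1 - v := by simp [hz]; ring
    rw [hre, abs_of_neg (by linarith)] at this
    linarith
  have htri : ‖z‖ ≤ ‖1 + Complex.I * z‖ + 1 := by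
    simpa using norm_sub_le (1 + Complex.I * z) 1
  have hone : 1 ≤ 1 / (v - 1) * ‖1 + Complex.I * z‖ := by
    rw [one_div, inv_mul_eq_div, le_div_iff₀ (by linarith)]
    linarith
  linarith

lemma continuous_fourier {f : ℝ → ℂ} (hf : Integrable f) : Continuous (𝓕 f) :=
  VectorFourier.fourierIntegral_continuous Real.continuous_fourierChar (by fun_prop) hf

lemma continuous_fourierInv {f : ℝ → ℂ} (hf : Integrable f) : Continuous (𝓕⁻ f) := by
  have h := (continuous_fourier hf).comp continuous_neg
  rwa [show 𝓕 f ∘ Neg.neg = 𝓕⁻ f from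
    funext fun w => (Real.fourierInv_eq_fourier_neg f w).symm] at h

/-- Lewis-type representation of the asset-or-nothing price, equation (8) of the paper:
if `∫ |φ(u+iv)|/|u+iv| du < ∞` (with `v > 1`) then
`∫_{(x,∞)} e^s μ(ds) = -(1/2π) ∫ e^{(1+i(u+iv))x} φ(u+iv) / (1+i(u+iv)) du`. -/
theorem asset_or_nothing_Lewis
    (v τ : ℝ) (hv : 1 < v) (hτ : 0 < τ)
    (μ : Measure ℝ) [IsProbabilityMeasure μ]
    (hμv : Integrable (fun s : ℝ => Real.exp (v * s)) μ)
    (hmart1 : Integrable (fun s : ℝ => Real.exp s) μ)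
    (hmart2 : ∫ s : ℝ, Real.exp s ∂μ = 1)
    (φ : ℂ → ℂ)
    (hφ : ∀ z : ℂ, φ z = ∫ s : ℝ, Complex.exp (-(Complex.I * z * (s : ℂ))) ∂μ)
    (hint : Integrable (fun u : ℝ =>
      ‖φ ((u : ℂ) + (v : ℂ) * Complex.I)‖ / ‖(u : ℂ) + (v : ℂ) * Complex.I‖)) :
    ∀ x : ℝ,
      ((∫ s in Set.Ioi x, Real.exp s ∂μ : ℝ) : ℂ) =
        -(1 / (2 * (Real.pi : ℂ))) *
          ∫ u : ℝ,
            Complex.exp ((1 + Complex.I * ((u : ℂ) + (v : ℂ) * Complex.I)) * (x : ℂ)) *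
              φ ((u : ℂ) + (v : ℂ) * Complex.I) /
                (1 + Complex.I * ((u : ℂ) + (v : ℂ) * Complex.I)) := by
  have ha : 0 < v - 1 := by linarith
  set a : ℝ := v - 1 with ha_def
  set Φ : ℝ → ℂ := fun u => φ ((u : ℂ) + (v : ℂ) * Complex.I) /
    (1 + Complex.I * ((u : ℂ) + (v : ℂ) * Complex.I)) with hΦ
  set h : ℝ → ℂ := fun x =>
    Complex.exp ((a : ℂ) * x) * ((∫ s in Set.Ioi x, Real.exp s ∂μ : ℝ) : ℂ) with hh
  have hre (w : ℝ) : ((a : ℂ) - (2 * Real.pi * w : ℝ) * Complex.I).re = a := by simp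
  have hμa : Integrable (fun s : ℝ => Real.exp ((a + 1) * s)) μ := by
    simpa [ha_def] using hμv
  have h_int : Integrable h :=
    integrable_exp_mul_setIntegral_Ioi_exp (c := (a : ℂ)) (by simpa using ha) (by simpa using hμa)
  have h_four (w : ℝ) : 𝓕 h w = -Φ (2 * Real.pi * w) := by
    have key := integral_exp_mul_setIntegral_Ioi_exp (μ := μ)
      (c := (a : ℂ) - (2 * Real.pi * w : ℝ) * Complex.I) (by rwa [hre]) (by rwa [hre])
    have hden : (a : ℂ) - (2 * Real.pi * w : ℝ) * Complex.I =
        -(1 + Complex.I * (((2 * Real.pi * w : ℝ) : ℂ) + v * Complex.I)) := by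
      push_cast [ha_def]
      linear_combination (v : ℂ) * Complex.I_mul_I
    rw [Real.fourier_real_eq_integral_exp_smul, hΦ]
    simp only [hφ]
    rw [← div_neg, ← hden]
    refine Eq.trans (integral_congr_ae (.of_forall fun x => ?_)) (key.trans ?_)
    · simp only [hh]
      rw [smul_eq_mul, ← mul_assoc, ← Complex.exp_add]
      congr 2
      push_cast
      ring
    · congr 1
      refine integral_congr_ae (.of_forall fun s => ?_)
      simp only [hden]
      congr 1
      ring
  have h_four_int : Integrable (𝓕 h) := by
    refine Integrable.mono' ((hint.const_mul (1 + 1 / (v - 1))).comp_mul_left'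
      (R := 2 * Real.pi) (by positivity)) (continuous_fourier h_int).aestronglyMeasurable
      (.of_forall fun w => ?_)
    rw [h_four, norm_neg, hΦ]
    set u : ℝ := 2 * Real.pi * w
    have hle := norm_le_mul_norm_one_add_I_mul hv u
    have hz : 0 < ‖(u : ℂ) + v * Complex.I‖ := by
      refine norm_pos_iff.2 fun h0 => ?_
      have := congrArg Complex.im h0
      simp at this
      linarith
    have hC : 0 < 1 + 1 / (v - 1) := by positivity
    have hd : 0 < ‖1 + Complex.I * ((u : ℂ) + v * Complex.I)‖ :=
      pos_of_mul_pos_right (hz.trans_le hle) hC.le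
    rw [norm_div, mul_div_assoc', div_le_div_iff₀ hd hz, mul_comm (1 + 1 / (v - 1)), mul_assoc]
    gcongr
  have hinv (x : ℝ) : 𝓕⁻ (𝓕 h) x = h x := by
    have htail : Tendsto h (𝓝[>] x) (𝓝 (h x)) := by
      refine Tendsto.mul ?_ ((Complex.continuous_ofReal.tendsto _).comp
        (tendsto_setIntegral_Ioi_nhdsGT hmart1 x))
      exact (Continuous.tendsto (by fun_prop) x).mono_left nhdsWithin_le_nhds
    refine tendsto_nhds_unique_of_frequently_eq
      (((continuous_fourierInv h_four_int).tendsto x).mono_left nhdsWithin_le_nhds) htail ?_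
    have hdense := (antitone_setIntegral_Ioi_exp hmart1).countable_not_continuousAt.dense_compl ℝ
    rw [frequently_iff]
    intro U hU
    obtain ⟨b, hxb, hb⟩ := (mem_nhdsGT_iff_exists_Ioo_subset).1 hU
    obtain ⟨y, hy, hyb⟩ := hdense.exists_mem_open isOpen_Ioo (Set.nonempty_Ioo.2 hxb)
    refine ⟨y, hb hyb, h_int.fourierInv_fourier_eq h_four_int ?_⟩
    refine ContinuousAt.mul (by fun_prop) (Complex.continuous_ofReal.continuousAt.comp ?_)
    simpa using hy
  intro x
  have hx := hinv x
  have hscale := Measure.integral_comp_mul_left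
    (fun u : ℝ => Complex.exp ((u * x : ℝ) * Complex.I) * -Φ u) (2 * Real.pi)
  have hx' : (1 / (2 * (Real.pi : ℂ))) * ∫ u : ℝ, Complex.exp ((u * x : ℝ) * Complex.I) * -Φ u =
      h x := by
    rw [← hx, Real.fourierInv_eq']
    simp only [h_four, smul_eq_mul]
    convert hscale.symm using 1
    · rw [abs_of_pos (by positivity), Complex.real_smul]
      push_cast
      simp
    · congr 1 with w
      congr 3
      simp
      ring
  have hG : ((∫ s in Set.Ioi x, Real.exp s ∂μ : ℝ) : ℂ) =
      Complex.exp (-((a : ℂ) * x)) * h x := by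
    rw [hh, ← mul_assoc, ← Complex.exp_add]
    simp
  rw [hG, ← hx', mul_left_comm, ← integral_const_mul, neg_mul_comm, ← integral_neg]
  congr 2 with u
  rw [hΦ, mul_neg, mul_neg, ← mul_assoc, ← Complex.exp_add, mul_div_assoc]
  congr 3
  push_cast [ha_def]
  linear_combination (-(v : ℂ) * x) * Complex.I_mul_I
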